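/- Let ρ̄_t be a map from bounded ℱ̄-measurable functions on Ω̄ to bounded ℱ̄_t-measurable functions satisfying: ρ̄_t(X + m) = ρ̄_t(X) − m P̄-a.s. for every bounded ℱ̄_t-measurable m; ρ̄_t(X) ≥ ρ̄_t(Y) P̄-a.s. whenever X ≤ Y P̄-a.e.; ρ̄_t(λX + (1−λ)Y) ≤ λρ̄_t(X) + (1−λ)ρ̄_t(Y) P̄-a.s. for every ℱ̄_t-measurable λ with 0 ≤ λ ≤ 1; and ρ̄_t(0) = 0 P̄-a.s. Define ρ_t(X)(ω) := ρ̄_t(X)(ω, t) for X ∈ ℛ_t^∞. Then ρ_t : ℛ_t^∞ → L^∞_t is a conditional convex risk measure for processes, and for every bounded ℱ̄-measurable X one has, P̄-a.s., ρ̄_t(X)(ω,s) = −X_s(ω) for s < t and ρ̄_t(X)(ω,s) = ρ_t(π_t(X))(ω) for s ≥ t. -/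

import Mathlib

open MeasureTheory Filter

variable {Ω : Type*}

/-- Bounded measurable real-valued functions with respect to a σ-algebra (the space `L^∞`). -/
def BddMeas {α : Type*} (mm : MeasurableSpace α) (f : α → ℝ) : Prop :=
  Measurable[mm] f ∧ ∃ C : ℝ, ∀ x, |f x| ≤ C

/-- The space `ℛ^∞` of bounded adapted processes. -/
def MemRinf {m : MeasurableSpace Ω} (F : Filtration ℕ m) (X : ℕ → Ω → ℝ) : Prop :=
  (∀ s, Measurable[F s] (X s)) ∧ ∃ C : ℝ, ∀ s ω, |X s ω| ≤ C

/-- The projection `π_t` killing a process strictly before time `t`. -/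
def projt (t : ℕ) (X : ℕ → Ω → ℝ) : ℕ → Ω → ℝ := fun r ω => if t ≤ r then X r ω else 0

/-- Membership in `ℛ_t^∞ = π_t(ℛ^∞)`: bounded adapted processes vanishing before `t`. -/
def MemRt {m : MeasurableSpace Ω} (F : Filtration ℕ m) (t : ℕ) (X : ℕ → Ω → ℝ) : Prop :=
  MemRinf F X ∧ ∀ r < t, ∀ ω, X r ω = 0

/-- A conditional convex risk measure for processes at time `t`. -/
structure IsCondRiskMeasure {m : MeasurableSpace Ω} (F : Filtration ℕ m) (P : Measure Ω)
    (t : ℕ) (ρ : (ℕ → Ω → ℝ) → Ω → ℝ) : Prop where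
  map_into : ∀ X, MemRt F t X → BddMeas (F t) (ρ X)
  cash : ∀ X, MemRt F t X → ∀ mf : Ω → ℝ, BddMeas (F t) mf →
    ρ (fun r ω => X r ω + if t ≤ r then mf ω else 0) =ᵐ[P] fun ω => ρ X ω - mf ω
  mono : ∀ X Y, MemRt F t X → MemRt F t Y → (∀ s, ∀ᵐ ω ∂P, X s ω ≤ Y s ω) →
    ∀ᵐ ω ∂P, ρ Y ω ≤ ρ X ω
  convex : ∀ X Y, MemRt F t X → MemRt F t Y → ∀ lam : Ω → ℝ,
    Measurable[F t] lam → (∀ ω, 0 ≤ lam ω ∧ lam ω ≤ 1) →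
    ∀ᵐ ω ∂P, ρ (fun r ω => lam ω * X r ω + (1 - lam ω) * Y r ω) ω ≤
      lam ω * ρ X ω + (1 - lam ω) * ρ Y ω
  norm : ρ (fun _ _ => 0) =ᵐ[P] (0 : Ω → ℝ)

/-- The optional σ-field `ℱ̄` on `Ω̄ = Ω × ℕ`. -/
def optionalSigma {m : MeasurableSpace Ω} (F : Filtration ℕ m) :
    MeasurableSpace (Ω × ℕ) :=
  MeasurableSpace.generateFrom
    {B | ∃ (t : ℕ) (A : Set Ω), MeasurableSet[F t] A ∧ B = A ×ˢ ({t} : Set ℕ)}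

/-- The optional filtration `ℱ̄_t` on `Ω̄ = Ω × ℕ`. -/
def optionalFiltration {m : MeasurableSpace Ω} (F : Filtration ℕ m) (t : ℕ) :
    MeasurableSpace (Ω × ℕ) :=
  MeasurableSpace.generateFrom
    ({B | ∃ (j : ℕ) (A : Set Ω), j < t ∧ MeasurableSet[F j] A ∧ B = A ×ˢ ({j} : Set ℕ)} ∪
      {B | ∃ A : Set Ω, MeasurableSet[F t] A ∧ B = A ×ˢ {s : ℕ | t ≤ s}})

theorem measurable_optionalSigma_mk {m : MeasurableSpace Ω} (F : Filtration ℕ m) (s : ℕ) :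
    Measurable[F s, optionalSigma F] (fun ω : Ω => (ω, s)) := by
  refine @measurable_generateFrom _ _ (F s) _ _ ?_
  rintro _ ⟨j, A, hA, rfl⟩
  by_cases h : s = j
  · subst h
    convert hA using 1
    ext ω; simp
  · convert @MeasurableSet.empty _ (F s) using 1
    ext ω; simp [h]

theorem measurable_optionalSigma_of_sections {m : MeasurableSpace Ω} {F : Filtration ℕ m}
    {X : Ω × ℕ → ℝ} (hX : ∀ s, Measurable[F s] fun ω => X (ω, s)) :
    Measurable[optionalSigma F] X := by
  intro B hB
  have h : X ⁻¹' B = ⋃ s : ℕ, ((fun ω => X (ω, s)) ⁻¹' B) ×ˢ ({s} : Set ℕ) := by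
    ext ⟨ω, s⟩; simp
  rw [h]
  exact @MeasurableSet.iUnion _ _ (optionalSigma F) _ _ fun s =>
    MeasurableSpace.measurableSet_generateFrom ⟨s, _, hX s hB, rfl⟩

theorem measurable_section_of_optionalSigma {m : MeasurableSpace Ω} {F : Filtration ℕ m}
    {X : Ω × ℕ → ℝ} (hX : Measurable[optionalSigma F] X) (s : ℕ) :
    Measurable[F s] fun ω => X (ω, s) :=
  @Measurable.comp _ _ _ (F s) (optionalSigma F) _ _ _ hX (measurable_optionalSigma_mk F s)

theorem measurable_section_of_optionalFiltration {m : MeasurableSpace Ω} {F : Filtration ℕ m}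
    {t : ℕ} {Y : Ω × ℕ → ℝ} (hY : Measurable[optionalFiltration F t] Y) :
    Measurable[F t] fun ω => Y (ω, t) := by
  have h : Measurable[F t, optionalFiltration F t] (fun ω : Ω => (ω, t)) := by
    refine @measurable_generateFrom _ _ (F t) _ _ ?_
    rintro _ (⟨j, A, hj, hA, rfl⟩ | ⟨A, hA, rfl⟩)
    · convert @MeasurableSet.empty _ (F t) using 1
      ext ω; simp [hj.ne']
    · convert hA using 1
      ext ω; simp
  exact @Measurable.comp _ _ _ (F t) (optionalFiltration F t) _ _ _ hY h

theorem mem_iff_of_measurableSet_optionalFiltration {m : MeasurableSpace Ω} {F : Filtration ℕ m}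
    {t : ℕ} {B : Set (Ω × ℕ)} (hB : MeasurableSet[optionalFiltration F t] B)
    {s : ℕ} (hs : t ≤ s) (ω : Ω) : (ω, s) ∈ B ↔ (ω, t) ∈ B := by
  induction B, hB using MeasurableSpace.generateFrom_induction with
  | hC B hB _ =>
    rcases hB with ⟨j, A, hj, hA, rfl⟩ | ⟨A, hA, rfl⟩
    · simp [hj.ne', (hj.trans_le hs).ne']
    · simp [hs]
  | empty => simp
  | compl B _ ih => simpa using not_congr ih
  | iUnion f _ ih => simp [ih]

theorem eq_of_measurable_optionalFiltration {m : MeasurableSpace Ω} {F : Filtration ℕ m}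
    {t : ℕ} {Y : Ω × ℕ → ℝ} (hY : Measurable[optionalFiltration F t] Y)
    {s : ℕ} (hs : t ≤ s) (ω : Ω) : Y (ω, s) = Y (ω, t) :=
  (mem_iff_of_measurableSet_optionalFiltration
    (hY (measurableSet_singleton (Y (ω, t)))) hs ω).2 rfl

theorem measurable_optionalFiltration_ite {m : MeasurableSpace Ω} {F : Filtration ℕ m}
    {t : ℕ} {X : Ω × ℕ → ℝ} {Z : Ω → ℝ} (hX : ∀ s < t, Measurable[F s] fun ω => X (ω, s))
    (hZ : Measurable[F t] Z) :
    Measurable[optionalFiltration F t] fun p => if t ≤ p.2 then Z p.1 else X p := by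
  intro B hB
  have h : (fun p : Ω × ℕ => if t ≤ p.2 then Z p.1 else X p) ⁻¹' B =
      (⋃ s : ℕ, ⋃ _ : s < t, ((fun ω => X (ω, s)) ⁻¹' B) ×ˢ ({s} : Set ℕ)) ∪
        (Z ⁻¹' B) ×ˢ {s : ℕ | t ≤ s} := by
    ext ⟨ω, s⟩
    by_cases hs : t ≤ s
    · simp [hs]
    · simp [hs, not_le.1 hs]
  rw [h]
  refine @MeasurableSet.union _ (optionalFiltration F t) _ _ ?_ ?_
  · exact @MeasurableSet.iUnion _ _ (optionalFiltration F t) _ _ fun s =>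
      @MeasurableSet.iUnion _ _ (optionalFiltration F t) _ _ fun hs =>
        MeasurableSpace.measurableSet_generateFrom (Or.inl ⟨s, _, hs, hX s hs hB, rfl⟩)
  · exact MeasurableSpace.measurableSet_generateFrom (Or.inr ⟨_, hZ hB, rfl⟩)

section ProductMeasure

variable {m : MeasurableSpace Ω} {F : Filtration ℕ m} {P : Measure Ω}
  {μ : ℕ → Ω → ℝ} {Pbar : @Measure (Ω × ℕ) (optionalSigma F)}

theorem ae_section_of_ae_optional [IsFiniteMeasure P]
    (hμ_meas : ∀ s, Measurable[F s] (μ s))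
    (hμ_pos : ∀ s, ∀ᵐ ω ∂P, 0 < μ s ω)
    (hμ_sum : ∀ᵐ ω ∂P, HasSum (fun s => μ s ω) 1)
    (hPbar : ∀ X : Ω × ℕ → ℝ, Measurable[optionalSigma F] X →
      (∃ C : ℝ, ∀ p, |X p| ≤ C) →
      ∫ p, X p ∂Pbar = ∫ ω, ∑' s, X (ω, s) * μ s ω ∂P)
    {Q : Ω × ℕ → Prop} (hQ : ∀ᵐ p ∂Pbar, Q p) (s : ℕ) : ∀ᵐ ω ∂P, Q (ω, s) := by
  obtain ⟨N, hQN, hN, hN0⟩ := @exists_measurable_superset_of_null _ (optionalSigma F) _ _ (ae_iff.1 hQ)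
  let A : Set Ω := (fun ω => (ω, s)) ⁻¹' N
  have hA : MeasurableSet[F s] A := measurable_optionalSigma_mk F s hN
  have hAm : MeasurableSet A := F.le s _ hA
  let X : Ω × ℕ → ℝ := fun p => if p.2 = s then A.indicator (fun _ => (1 : ℝ)) p.1 else 0
  have hX : Measurable[optionalSigma F] X := by
    refine measurable_optionalSigma_of_sections fun r => ?_
    by_cases hr : r = s
    · subst hr
      simpa [X] using (@measurable_const _ _ _ (F r) (1 : ℝ)).indicator hA
    · simp [X, hr]
  have hXb : ∃ C : ℝ, ∀ p, |X p| ≤ C := by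
    refine ⟨1, fun p => ?_⟩
    by_cases h1 : p.2 = s <;> by_cases h2 : p.1 ∈ A <;> simp [X, h1, h2]
  have hX0 : ∫ p, X p ∂Pbar = 0 := by
    refine integral_eq_zero_of_ae ?_
    filter_upwards [compl_mem_ae_iff.2 hN0] with p hp
    obtain ⟨ω, r⟩ := p
    by_cases hr : r = s
    · subst hr
      have : ω ∉ A := hp
      simp [X, this]
    · simp [X, hr]
  have htsum : ∀ ω, ∑' r, X (ω, r) * μ r ω = A.indicator (μ s) ω := by
    intro ω
    rw [tsum_eq_single s (fun r hr => by simp [X, hr])]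
    by_cases h : ω ∈ A <;> simp [X, h]
  have hint : ∫ ω, A.indicator (μ s) ω ∂P = 0 := by
    rw [← hX0, hPbar X hX hXb]
    exact integral_congr_ae (Eventually.of_forall fun ω => (htsum ω).symm)
  have hpos : ∀ᵐ ω ∂P, ∀ r, 0 < μ r ω := ae_all_iff.2 hμ_pos
  have hnonneg : 0 ≤ᵐ[P] A.indicator (μ s) := by
    filter_upwards [hpos] with ω hω
    exact Set.indicator_apply_nonneg fun _ => (hω s).le
  have hmeas : Measurable (A.indicator (μ s)) :=
    ((hμ_meas s).mono (F.le s) le_rfl).indicator hAm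
  have hintegrable : Integrable (A.indicator (μ s)) P := by
    refine Integrable.of_bound hmeas.aestronglyMeasurable 1 ?_
    filter_upwards [hpos, hμ_sum] with ω hω hsum
    have h1 : μ s ω ≤ 1 := le_hasSum hsum s fun r _ => (hω r).le
    by_cases h : ω ∈ A
    · simpa [h, abs_of_pos (hω s)] using h1
    · simp [h]
  filter_upwards [(integral_eq_zero_iff_of_nonneg_ae hnonneg hintegrable).1 hint, hμ_pos s]
    with ω h0 hω
  by_contra hn
  have hmem : ω ∈ A := hQN hn
  simp only [hmem, Set.indicator_of_mem, Pi.zero_apply] at h0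
  exact hω.ne' h0

theorem ae_optional_of_ae_section
    (hPbar_prob : IsProbabilityMeasure Pbar)
    (hPbar : ∀ X : Ω × ℕ → ℝ, Measurable[optionalSigma F] X →
      (∃ C : ℝ, ∀ p, |X p| ≤ C) →
      ∫ p, X p ∂Pbar = ∫ ω, ∑' s, X (ω, s) * μ s ω ∂P)
    {Q : Ω × ℕ → Prop} (hQm : MeasurableSet[optionalSigma F] {p | Q p})
    (hQ : ∀ s, ∀ᵐ ω ∂P, Q (ω, s)) : ∀ᵐ p ∂Pbar, Q p := by
  have hc : MeasurableSet[optionalSigma F] {p | ¬ Q p} := hQm.compl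
  have h := hPbar ({p | ¬ Q p}.indicator fun _ => (1 : ℝ))
    ((@measurable_const _ _ _ (optionalSigma F) (1 : ℝ)).indicator hc)
    ⟨1, fun p => by by_cases hp : Q p <;> simp [hp]⟩
  have h0 : ∫ ω, ∑' s, {p | ¬ Q p}.indicator (fun _ => (1 : ℝ)) (ω, s) * μ s ω ∂P = 0 := by
    refine integral_eq_zero_of_ae ?_
    filter_upwards [ae_all_iff.2 hQ] with ω hω
    simp [hω]
  rw [h0, integral_indicator_const _ hc] at h
  have h1 : Pbar.real {p | ¬ Q p} = 0 := by simpa using h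
  exact ae_iff.2 ((measureReal_eq_zero_iff (by finiteness)).1 h1)

end ProductMeasure

/-- **From risk measures for random variables on the optional σ-field back to risk
measures for processes.**  If `ρ̄_t` maps bounded `ℱ̄`-measurable functions to bounded
`ℱ̄_t`-measurable functions and is a conditional convex risk measure for random variables
with respect to `(ℱ̄_t, P̄)`, then `ρ_t(X)(ω) := ρ̄_t(X)(ω,t)` defines a conditional convex
risk measure for processes, and `ρ̄_t(X)(ω,s) = −X_s(ω)` for `s < t`,
`ρ̄_t(X)(ω,s) = ρ_t(π_t X)(ω)` for `s ≥ t`, `P̄`-a.s. -/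
theorem stmt_4 {m : MeasurableSpace Ω} (F : Filtration ℕ m)
    (P : Measure Ω) [IsProbabilityMeasure P]
    (hF0 : ∀ A : Set Ω, MeasurableSet[F 0] A → P A = 0 ∨ P A = 1)
    (μ : ℕ → Ω → ℝ)
    (hμ_meas : ∀ s, Measurable[F s] (μ s))
    (hμ_pos : ∀ s, ∀ᵐ ω ∂P, 0 < μ s ω)
    (hμ_sum : ∀ᵐ ω ∂P, HasSum (fun s => μ s ω) 1)
    (Pbar : @Measure (Ω × ℕ) (optionalSigma F))
    (hPbar_prob : IsProbabilityMeasure Pbar)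
    (hPbar : ∀ X : Ω × ℕ → ℝ, Measurable[optionalSigma F] X →
      (∃ C : ℝ, ∀ p, |X p| ≤ C) →
      ∫ p, X p ∂Pbar = ∫ ω, ∑' s, X (ω, s) * μ s ω ∂P)
    (t : ℕ) (ρbar : (Ω × ℕ → ℝ) → Ω × ℕ → ℝ)
    -- `ρ̄_t` maps bounded `ℱ̄`-measurable functions to bounded `ℱ̄_t`-measurable functions
    (hinto : ∀ Xb : Ω × ℕ → ℝ, Measurable[optionalSigma F] Xb →
      (∃ C : ℝ, ∀ p, |Xb p| ≤ C) → BddMeas (optionalFiltration F t) (ρbar Xb))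
    -- conditional cash invariance
    (hcash : ∀ Xb : Ω × ℕ → ℝ, Measurable[optionalSigma F] Xb →
      (∃ C : ℝ, ∀ p, |Xb p| ≤ C) →
      ∀ mb : Ω × ℕ → ℝ, BddMeas (optionalFiltration F t) mb →
        ρbar (fun p => Xb p + mb p) =ᵐ[Pbar] fun p => ρbar Xb p - mb p)
    -- monotonicity
    (hmono : ∀ Xb Yb : Ω × ℕ → ℝ, Measurable[optionalSigma F] Xb →
      (∃ C : ℝ, ∀ p, |Xb p| ≤ C) →
      Measurable[optionalSigma F] Yb → (∃ C : ℝ, ∀ p, |Yb p| ≤ C) →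
      (∀ᵐ p ∂Pbar, Xb p ≤ Yb p) →
      ∀ᵐ p ∂Pbar, ρbar Yb p ≤ ρbar Xb p)
    -- conditional convexity
    (hconv : ∀ Xb Yb : Ω × ℕ → ℝ, Measurable[optionalSigma F] Xb →
      (∃ C : ℝ, ∀ p, |Xb p| ≤ C) →
      Measurable[optionalSigma F] Yb → (∃ C : ℝ, ∀ p, |Yb p| ≤ C) →
      ∀ lam : Ω × ℕ → ℝ, Measurable[optionalFiltration F t] lam →
        (∀ p, 0 ≤ lam p ∧ lam p ≤ 1) →
        ∀ᵐ p ∂Pbar,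
          ρbar (fun q => lam q * Xb q + (1 - lam q) * Yb q) p ≤
            lam p * ρbar Xb p + (1 - lam p) * ρbar Yb p)
    -- normalization
    (hnorm : ρbar (fun _ => 0) =ᵐ[Pbar] (0 : Ω × ℕ → ℝ)) :
    IsCondRiskMeasure F P t (fun X ω => ρbar (fun p => X p.2 p.1) (ω, t)) ∧
    ∀ Xb : Ω × ℕ → ℝ, Measurable[optionalSigma F] Xb → (∃ C : ℝ, ∀ p, |Xb p| ≤ C) →
      ρbar Xb =ᵐ[Pbar] fun p =>
        if p.2 < t then -Xb p
        else ρbar (fun q => projt t (fun r ω => Xb (ω, r)) q.2 q.1) (p.1, t) := by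
  have hsec : ∀ {Q : Ω × ℕ → Prop}, (∀ᵐ p ∂Pbar, Q p) → ∀ᵐ ω ∂P, Q (ω, t) := fun hQ =>
    ae_section_of_ae_optional hμ_meas hμ_pos hμ_sum hPbar hQ t
  have hproc : ∀ {X : ℕ → Ω → ℝ}, MemRt F t X →
      Measurable[optionalSigma F] (fun p : Ω × ℕ => X p.2 p.1) ∧
        ∃ C : ℝ, ∀ p : Ω × ℕ, |X p.2 p.1| ≤ C := fun hX =>
    ⟨measurable_optionalSigma_of_sections hX.1.1, hX.1.2.imp fun C hC p => hC p.2 p.1⟩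
  have hzero : Measurable[optionalSigma F] (fun _ : Ω × ℕ => (0 : ℝ)) :=
    @measurable_const _ _ _ (optionalSigma F) 0
  have hzero_bdd : ∃ C : ℝ, ∀ _ : Ω × ℕ, |(0 : ℝ)| ≤ C := ⟨0, fun _ => by simp⟩
  refine ⟨⟨?_, ?_, ?_, ?_, ?_⟩, ?_⟩
  · intro X hX
    obtain ⟨hm, C, hC⟩ := hinto _ (hproc hX).1 (hproc hX).2
    exact ⟨measurable_section_of_optionalFiltration hm, C, fun ω => hC _⟩
  · rintro X hX mf ⟨hmf, C, hC⟩
    have hmb : BddMeas (optionalFiltration F t)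
        (fun p : Ω × ℕ => if t ≤ p.2 then mf p.1 else 0) := by
      refine ⟨measurable_optionalFiltration_ite (X := fun _ => 0)
        (fun s _ => @measurable_const _ _ _ (F s) 0) hmf, C, fun p => ?_⟩
      by_cases hp : t ≤ p.2
      · simpa [hp] using hC p.1
      · simpa [hp] using (abs_nonneg _).trans (hC p.1)
    filter_upwards [hsec (hcash _ (hproc hX).1 (hproc hX).2 _ hmb)] with ω hω
    simpa using hω
  · intro X Y hX hY hXY
    refine hsec (hmono _ _ (hproc hX).1 (hproc hX).2 (hproc hY).1 (hproc hY).2 ?_)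
    exact ae_optional_of_ae_section hPbar_prob hPbar
      (@measurableSet_le _ _ _ _ _ (optionalSigma F) _ _ _ _ _ (hproc hX).1 (hproc hY).1) hXY
  · intro X Y hX hY lam hlam hlam01
    have h := hsec (hconv _ _ (hproc hX).1 (hproc hX).2 (hproc hY).1 (hproc hY).2
      (fun p => if t ≤ p.2 then lam p.1 else 0)
      (measurable_optionalFiltration_ite (X := fun _ => 0)
        (fun s _ => @measurable_const _ _ _ (F s) 0) hlam)
      (fun p => by
        by_cases hp : t ≤ p.2
        · simpa [hp] using hlam01 p.1
        · simp [hp]))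
    have heq : (fun q : Ω × ℕ => (if t ≤ q.2 then lam q.1 else 0) * X q.2 q.1 +
        (1 - if t ≤ q.2 then lam q.1 else 0) * Y q.2 q.1) =
        fun q => lam q.1 * X q.2 q.1 + (1 - lam q.1) * Y q.2 q.1 := by
      funext q
      by_cases hq : t ≤ q.2
      · simp [hq]
      · simp [hX.2 _ (not_le.1 hq), hY.2 _ (not_le.1 hq)]
    rw [heq] at h
    filter_upwards [h] with ω hω
    simpa using hω
  · exact hsec hnorm
  · rintro Xb hXb ⟨C, hC⟩
    set Z : Ω × ℕ → ℝ := fun q => projt t (fun r ω => Xb (ω, r)) q.2 q.1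
    have hZ : Measurable[optionalSigma F] Z := by
      refine measurable_optionalSigma_of_sections fun s => ?_
      by_cases hs : t ≤ s
      · simpa [Z, projt, hs] using measurable_section_of_optionalSigma hXb s
      · simp [Z, projt, hs]
    have hZ_bdd : ∃ C : ℝ, ∀ p, |Z p| ≤ C := by
      refine ⟨C, fun p => ?_⟩
      by_cases hp : t ≤ p.2
      · simpa [Z, projt, hp] using hC p
      · simpa [Z, projt, hp] using (abs_nonneg _).trans (hC p)
    have hpast : BddMeas (optionalFiltration F t)
        (fun p : Ω × ℕ => if t ≤ p.2 then 0 else Xb p) := by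
      refine ⟨measurable_optionalFiltration_ite (Z := fun _ => 0)
        (fun s _ => measurable_section_of_optionalSigma hXb s)
        (@measurable_const _ _ _ (F t) 0), C, fun p => ?_⟩
      by_cases hp : t ≤ p.2
      · simpa [hp] using (abs_nonneg _).trans (hC p)
      · simpa [hp] using hC p
    have hfuture : Measurable[optionalFiltration F t]
        (fun p : Ω × ℕ => if t ≤ p.2 then (1 : ℝ) else 0) :=
      measurable_optionalFiltration_ite (X := fun _ => 0) (Z := fun _ => 1)
        (fun s _ => @measurable_const _ _ _ (F s) 0) (@measurable_const _ _ _ (F t) 1)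
    have hbefore : Measurable[optionalFiltration F t]
        (fun p : Ω × ℕ => if t ≤ p.2 then (0 : ℝ) else 1) :=
      measurable_optionalFiltration_ite (X := fun _ => 1) (Z := fun _ => 0)
        (fun s _ => @measurable_const _ _ _ (F s) 1) (@measurable_const _ _ _ (F t) 0)
    have hsplit := hcash Z hZ hZ_bdd _ hpast
    have hupper := hconv Z (fun _ => 0) hZ hZ_bdd hzero hzero_bdd _ hfuture
      (fun p => by by_cases hp : t ≤ p.2 <;> simp [hp])
    have hlower := hconv Z (fun _ => 0) hZ hZ_bdd hzero hzero_bdd _ hbefore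
      (fun p => by by_cases hp : t ≤ p.2 <;> simp [hp])
    have e1 : (fun p => Z p + if t ≤ p.2 then 0 else Xb p) = Xb := by
      funext p
      by_cases hp : t ≤ p.2 <;> simp [Z, projt, hp]
    have e2 : (fun q : Ω × ℕ => (if t ≤ q.2 then (1 : ℝ) else 0) * Z q +
        (1 - if t ≤ q.2 then (1 : ℝ) else 0) * 0) = Z := by
      funext p
      by_cases hp : t ≤ p.2 <;> simp [Z, projt, hp]
    have e3 : (fun q : Ω × ℕ => (if t ≤ q.2 then (0 : ℝ) else 1) * Z q +
        (1 - if t ≤ q.2 then (0 : ℝ) else 1) * 0) = fun _ => 0 := by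
      funext p
      by_cases hp : t ≤ p.2 <;> simp [Z, projt, hp]
    rw [e1] at hsplit
    rw [e2] at hupper
    rw [e3] at hlower
    filter_upwards [hsplit, hupper, hlower, hnorm] with p h1 h2 h3 h4
    rw [h1]
    rw [h4] at h2 h3
    by_cases hp : t ≤ p.2
    · simpa [hp, not_lt.2 hp] using
        eq_of_measurable_optionalFiltration (hinto Z hZ hZ_bdd).1 hp p.1
    · simp only [hp, not_le.1 hp, if_true, if_false, Pi.zero_apply] at h2 h3 ⊢
      linarith
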